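/- For every n ≥ 1 and every t > 0, letting R_n'(t) denote the derivative of t ↦ R_n(t) (which exists), one has σ_n(t) = 1/4 + 2t − n R_n(t) − R_n(t)²/4 − t R_n'(t)/R_n(t) + t² ((R_n'(t))² − 4)/R_n(t)². -/

import Mathlib

open MeasureTheory Polynomial

/-- The singularly perturbed Gaussian weight `w(x,t) = exp(-x^2 - t/x^2)` for `x ≠ 0`,
extended by `0` at `x = 0`. -/
noncomputable def w (t x : ℝ) : ℝ := if x = 0 then 0 else Real.exp (-x ^ 2 - t / x ^ 2)

theorem measurable_w (t : ℝ) : Measurable (w t) := by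
  unfold w
  exact Measurable.ite (measurableSet_singleton 0) measurable_const (by fun_prop)

@[simp] theorem w_zero (t : ℝ) : w t 0 = 0 := by simp [w]

theorem w_of_ne {x : ℝ} (t : ℝ) (hx : x ≠ 0) : w t x = Real.exp (-x ^ 2 - t / x ^ 2) := by
  simp [w, hx]

theorem w_nonneg (t x : ℝ) : 0 ≤ w t x := by
  unfold w
  split_ifs <;> positivity

@[simp] theorem w_neg (t x : ℝ) : w t (-x) = w t x := by simp [w]

theorem w_anti {s t : ℝ} (hst : s ≤ t) (x : ℝ) : w t x ≤ w s x := by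
  unfold w
  split_ifs
  · exact le_rfl
  · gcongr

theorem w_le {t : ℝ} (ht : 0 < t) (j : ℕ) (x : ℝ) :
    w t x ≤ j.factorial / t ^ j * x ^ (2 * j) * Real.exp (-x ^ 2) := by
  rcases eq_or_ne x 0 with rfl | hx
  · rw [w_zero]; have := (even_two_mul j).pow_nonneg (0 : ℝ); positivity
  have hx2 : 0 < x ^ 2 := by positivity
  have key := Real.pow_div_factorial_le_exp (t / x ^ 2) (by positivity) j
  rw [w_of_ne t hx, sub_eq_add_neg, Real.exp_add, mul_comm (Real.exp (-x ^ 2))]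
  gcongr
  rw [Real.exp_neg]
  have hpos : 0 < (t / x ^ 2) ^ j / j.factorial := by positivity
  calc (Real.exp (t / x ^ 2))⁻¹ ≤ ((t / x ^ 2) ^ j / j.factorial)⁻¹ := inv_anti₀ hpos key
    _ = _ := by rw [pow_mul, div_pow]; field_simp

theorem integrable_eval_mul_exp_neg_sq (p : ℝ[X]) :
    Integrable fun x : ℝ => p.eval x * Real.exp (-x ^ 2) := by
  induction p using Polynomial.induction_on' with
  | add p q hp hq =>
    simp only [eval_add, add_mul]
    exact hp.add hq
  | monomial n a =>
    have := integrable_rpow_mul_exp_neg_mul_sq (b := 1) one_pos (s := n)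
      (by have : (0 : ℝ) ≤ n := n.cast_nonneg
          linarith)
    simpa [mul_assoc] using this.const_mul a

theorem integrable_eval_div_pow_mul_w {t : ℝ} (ht : 0 < t) (j : ℕ) (p : ℝ[X]) :
    Integrable fun x : ℝ => p.eval x / x ^ j * w t x := by
  refine ((integrable_eval_mul_exp_neg_sq (p * X ^ j)).const_mul (j.factorial / t ^ j)).mono
    (Measurable.aestronglyMeasurable ?_) (Filter.Eventually.of_forall fun x => ?_)
  · have := measurable_w t
    have := p.continuous.measurable
    fun_prop
  · rcases eq_or_ne x 0 with rfl | hx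
    · simp only [w_zero, mul_zero, norm_zero]; positivity
    have hxj : x ^ (2 * j) = |x| ^ j * |x| ^ j := by
      rw [← mul_pow, abs_mul_abs_self, pow_mul, pow_two]
    have hxp : 0 < |x| ^ j := by positivity
    rw [norm_mul, Real.norm_of_nonneg (w_nonneg t x), norm_div, norm_mul, norm_mul, norm_pow,
      eval_mul, eval_pow, eval_X, norm_mul, norm_pow, Real.norm_of_nonneg (Real.exp_pos _).le,
      Real.norm_of_nonneg (show 0 ≤ (j.factorial / t ^ j : ℝ) by positivity)]
    calc ‖p.eval x‖ / ‖x‖ ^ j * w t x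
        ≤ ‖p.eval x‖ / ‖x‖ ^ j * (j.factorial / t ^ j * x ^ (2 * j) * Real.exp (-x ^ 2)) := by
          gcongr
          exact w_le ht j x
      _ = _ := by rw [hxj, Real.norm_eq_abs x]; field_simp

theorem hasDerivAt_w {t : ℝ} (ht : 0 < t) (x : ℝ) :
    HasDerivAt (w t) ((-2 * x + 2 * t / x ^ 3) * w t x) x := by
  rcases eq_or_ne x 0 with rfl | hx
  · have hO : w t =O[nhds 0] fun x => ‖x - 0‖ ^ 2 := by
      refine Asymptotics.IsBigO.of_bound (1 / t) (Filter.Eventually.of_forall fun x => ?_)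
      have h1 := w_le ht 1 x
      have h2 : Real.exp (-x ^ 2) ≤ 1 := Real.exp_le_one_iff.mpr (by nlinarith [sq_nonneg x])
      rw [Real.norm_of_nonneg (w_nonneg t x)]
      simp only [sub_zero, norm_pow, Real.norm_eq_abs, sq_abs]
      refine h1.trans ?_
      simp only [Nat.factorial_one, Nat.cast_one, pow_one, mul_one]
      exact mul_le_of_le_one_right (by positivity) h2
    simpa using (hO.hasFDerivAt one_lt_two).hasDerivAt
  · have h1 : HasDerivAt (fun x : ℝ => Real.exp (-x ^ 2 - t / x ^ 2))
        (Real.exp (-x ^ 2 - t / x ^ 2) * (-2 * x + 2 * t / x ^ 3)) x := by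
      refine HasDerivAt.exp ?_
      have h2 := (hasDerivAt_pow 2 x).neg.sub
        ((hasDerivAt_const x t).div (hasDerivAt_pow 2 x) (by positivity))
      refine h2.congr_deriv ?_
      field_simp
      ring
    rw [w_of_ne t hx, mul_comm]
    refine h1.congr_of_eventuallyEq ?_
    filter_upwards [isOpen_ne.mem_nhds hx] with y hy using w_of_ne t hy

/-- The linear functional `p ↦ ∫ p(x) x⁻ʲ w(x,t) dx` on real polynomials. -/
noncomputable def moment (t : ℝ) (ht : 0 < t) (j : ℕ) : ℝ[X] →ₗ[ℝ] ℝ where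
  toFun p := ∫ x : ℝ, p.eval x / x ^ j * w t x
  map_add' p q := by
    rw [← integral_add (integrable_eval_div_pow_mul_w ht j p)
      (integrable_eval_div_pow_mul_w ht j q)]
    simp only [eval_add, add_div, add_mul]
  map_smul' c p := by
    simp only [eval_smul, smul_eq_mul, RingHom.id_apply, mul_div_assoc, mul_assoc,
      integral_const_mul]

theorem moment_apply {t : ℝ} (ht : 0 < t) (j : ℕ) (p : ℝ[X]) :
    moment t ht j p = ∫ x : ℝ, p.eval x / x ^ j * w t x := rfl

theorem moment_zero_apply {t : ℝ} (ht : 0 < t) (p : ℝ[X]) :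
    moment t ht 0 p = ∫ x : ℝ, p.eval x * w t x := by simp [moment_apply]

theorem moment_succ_X_mul {t : ℝ} (ht : 0 < t) (j : ℕ) (p : ℝ[X]) :
    moment t ht (j + 1) (X * p) = moment t ht j p := by
  simp only [moment_apply]
  refine integral_congr_ae (Filter.Eventually.of_forall fun x => ?_)
  rcases eq_or_ne x 0 with rfl | hx
  · simp
  · simp only [eval_mul, eval_X]
    field_simp
    ring

theorem moment_zero_comp_neg_X {t : ℝ} (ht : 0 < t) (p : ℝ[X]) :
    moment t ht 0 (p.comp (-X)) = moment t ht 0 p := by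
  rw [moment_zero_apply, moment_zero_apply,
    ← integral_neg_eq_self (fun x : ℝ => p.eval x * w t x)]
  simp

theorem moment_derivative {t : ℝ} (ht : 0 < t) (p : ℝ[X]) :
    moment t ht 0 (derivative p) = 2 * moment t ht 0 (X * p) - 2 * t * moment t ht 3 p := by
  have hd (x : ℝ) : HasDerivAt (fun x => p.eval x * w t x)
      ((derivative p).eval x * w t x - 2 * ((X * p).eval x * w t x)
        + 2 * t * (p.eval x / x ^ 3 * w t x)) x := by
    refine ((p.hasDerivAt x).mul (hasDerivAt_w ht x)).congr_deriv ?_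
    rw [eval_mul, eval_X]
    ring
  have h0 (q : ℝ[X]) : Integrable fun x : ℝ => q.eval x * w t x := by
    simpa using integrable_eval_div_pow_mul_w ht 0 q
  have h3 := (integrable_eval_div_pow_mul_w ht 3 p).const_mul (2 * t)
  have hX := (h0 (X * p)).const_mul 2
  have hsub : Integrable fun x : ℝ =>
      (derivative p).eval x * w t x - 2 * ((X * p).eval x * w t x) := (h0 _).sub hX
  have hint := integral_eq_zero_of_hasDerivAt_of_integrable hd
    (hsub.add h3) (h0 p)
  rw [integral_add hsub h3, integral_sub (h0 _) hX, integral_const_mul,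
    integral_const_mul, ← moment_zero_apply ht, ← moment_zero_apply ht,
    ← moment_apply ht] at hint
  linarith

theorem hasDerivAt_integral_eval_mul_w {t : ℝ} (ht : 0 < t) (p : ℝ[X]) :
    HasDerivAt (fun s => ∫ x : ℝ, p.eval x * w s x) (-moment t ht 2 p) t := by
  rw [moment_apply, ← integral_neg]
  have hpm := p.continuous.measurable
  refine (hasDerivAt_integral_of_dominated_loc_of_deriv_le
    (F' := fun s x => -(p.eval x / x ^ 2 * w s x))
    (bound := fun x => ‖p.eval x / x ^ 2 * w (t / 2) x‖)
    (Metric.ball_mem_nhds t (half_pos ht)) ?_ ?_ ?_ ?_ ?_ ?_).2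
  · refine Filter.Eventually.of_forall fun s => Measurable.aestronglyMeasurable ?_
    have := measurable_w s
    fun_prop
  · simpa using integrable_eval_div_pow_mul_w ht 0 p
  · have := measurable_w t
    exact Measurable.aestronglyMeasurable (by fun_prop)
  · refine Filter.Eventually.of_forall fun x s hs => ?_
    have hs' : t / 2 ≤ s := by
      have := abs_lt.mp (Real.dist_eq s t ▸ Metric.mem_ball.mp hs)
      linarith
    rw [norm_neg, norm_mul, norm_mul, Real.norm_of_nonneg (w_nonneg _ _),
      Real.norm_of_nonneg (w_nonneg _ _)]
    gcongr
    exact w_anti hs' x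
  · exact (integrable_eval_div_pow_mul_w (half_pos ht) 2 p).norm
  · refine Filter.Eventually.of_forall fun x s _ => ?_
    rcases eq_or_ne x 0 with rfl | hx
    · simpa using hasDerivAt_const s (0 : ℝ)
    · simp only [w_of_ne _ hx]
      have h1 := ((((hasDerivAt_id s).div_const (x ^ 2)).const_sub (-x ^ 2)).exp).const_mul
        (p.eval x)
      refine h1.congr_deriv ?_
      simp only [id]
      ring

/-- `P` is the sequence of monic orthogonal polynomials for the linear functional `L`. -/
structure IsMonicOrthogonal (L : ℝ[X] →ₗ[ℝ] ℝ) (P : ℕ → ℝ[X]) : Prop where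
  monic (n : ℕ) : (P n).Monic
  natDegree_eq (n : ℕ) : (P n).natDegree = n
  orthogonal {m n : ℕ} (hmn : m ≠ n) : L (P m * P n) = 0
  norm_pos (n : ℕ) : 0 < L (P n * P n)

namespace IsMonicOrthogonal

variable {L : ℝ[X] →ₗ[ℝ] ℝ} {P : ℕ → ℝ[X]}

theorem coeff_self (hP : IsMonicOrthogonal L P) (n : ℕ) : (P n).coeff n = 1 := by
  simpa [hP.natDegree_eq] using (hP.monic n).coeff_natDegree

theorem coeff_eq_zero (hP : IsMonicOrthogonal L P) {n k : ℕ} (hk : n < k) :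
    (P n).coeff k = 0 :=
  coeff_eq_zero_of_natDegree_lt (by rwa [hP.natDegree_eq])

theorem degree_lt (hP : IsMonicOrthogonal L P) {m n : ℕ} (h : m < n) : (P m).degree < n := by
  rw [degree_lt_iff_coeff_zero]
  exact fun k hk => hP.coeff_eq_zero (h.trans_le hk)

theorem degree_sub_lt (hP : IsMonicOrthogonal L P) {m : ℕ} {q : ℝ[X]}
    (hq : q.degree < (m + 1 : ℕ)) : (q - C (q.coeff m) * P m).degree < m := by
  rw [degree_lt_iff_coeff_zero] at hq ⊢
  intro k hk
  rcases hk.eq_or_lt with rfl | hk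
  · simp [hP.coeff_self]
  · simp [hq k hk, hP.coeff_eq_zero hk]

theorem apply_mul_eq_zero (hP : IsMonicOrthogonal L P) {n : ℕ} {q : ℝ[X]}
    (hq : q.degree < n) : L (P n * q) = 0 := by
  suffices ∀ m ≤ n, ∀ q : ℝ[X], q.degree < m → L (P n * q) = 0 from this n le_rfl q hq
  intro m
  induction m with
  | zero =>
    intro _ q hq
    rw [degree_lt_iff_coeff_zero] at hq
    have : q = 0 := by ext k; simpa using hq k k.zero_le
    simp [this]
  | succ m ih =>
    intro hm q hq
    have h1 := ih (by omega) _ (hP.degree_sub_lt hq)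
    have h2 := hP.orthogonal (show n ≠ m by omega)
    rw [mul_sub, map_sub, mul_left_comm, ← smul_eq_C_mul, map_smul, h2, smul_zero, sub_zero] at h1
    exact h1

theorem apply_mul (hP : IsMonicOrthogonal L P) {n : ℕ} {q : ℝ[X]}
    (hq : q.degree < (n + 1 : ℕ)) : L (P n * q) = q.coeff n * L (P n * P n) := by
  have h1 := hP.apply_mul_eq_zero (hP.degree_sub_lt hq)
  rw [mul_sub, map_sub, mul_left_comm, ← smul_eq_C_mul, map_smul, smul_eq_mul] at h1
  linarith

theorem eq_zero (hP : IsMonicOrthogonal L P) {m : ℕ} {q : ℝ[X]} (hq : q.degree < m)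
    (h : ∀ j < m, L (P j * q) = 0) : q = 0 := by
  induction m with
  | zero =>
    rw [degree_lt_iff_coeff_zero] at hq
    ext k
    simpa using hq k k.zero_le
  | succ m ih =>
    have h1 := h m m.lt_succ_self
    rw [hP.apply_mul hq] at h1
    have h2 := (mul_eq_zero.mp h1).resolve_right (hP.norm_pos m).ne'
    have h3 := hP.degree_sub_lt hq
    rw [h2, C_0, zero_mul, sub_zero] at h3
    exact ih h3 fun j hj => h j (by omega)

theorem comp_neg_X (hP : IsMonicOrthogonal L P) (hL : ∀ p : ℝ[X], L (p.comp (-X)) = L p)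
    (n : ℕ) : (P n).comp (-X) = C ((-1) ^ n) * P n := by
  have hc (p : ℝ[X]) (k : ℕ) : (p.comp (-X)).coeff k = (-1) ^ k * p.coeff k := by
    have := comp_C_mul_X_coeff (p := p) (r := (-1 : ℝ)) (n := k)
    rw [C_neg, C_1, neg_one_mul] at this
    rw [this, mul_comm]
  have hd {p : ℝ[X]} {m : ℕ} (hp : p.degree < m) : (p.comp (-X)).degree < m := by
    rw [degree_lt_iff_coeff_zero] at hp ⊢
    intro k hk
    rw [hc, hp k hk, mul_zero]
  rw [← sub_eq_zero]
  refine hP.eq_zero (m := n) ?_ fun j hj => ?_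
  · have := hP.degree_sub_lt (hd (hP.degree_lt n.lt_succ_self))
    rwa [hc, hP.coeff_self, mul_one] at this
  · rw [mul_sub, map_sub, mul_left_comm, ← smul_eq_C_mul, map_smul, hP.orthogonal hj.ne,
      smul_zero, sub_zero, ← hL, mul_comp, comp_assoc]
    simp only [neg_comp, X_comp, neg_neg, comp_X]
    rw [mul_comm]
    exact hP.apply_mul_eq_zero (hd (hP.degree_lt hj))

theorem coeff_eq_zero_of_odd_add (hP : IsMonicOrthogonal L P)
    (hL : ∀ p : ℝ[X], L (p.comp (-X)) = L p) {n k : ℕ} (h : Odd (n + k)) :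
    (P n).coeff k = 0 := by
  have h1 := congrArg (coeff · k) (hP.comp_neg_X hL n)
  have h2 := comp_C_mul_X_coeff (p := P n) (r := (-1 : ℝ)) (n := k)
  rw [C_neg, C_1, neg_one_mul] at h2
  simp only [h2, coeff_C_mul] at h1
  rcases n.even_or_odd with hn | hn
  · have hk : Odd k := (Nat.odd_add'.mp h).mpr hn
    rw [hn.neg_one_pow, hk.neg_one_pow] at h1
    linarith
  · have hk : Even k := (Nat.odd_add.mp h).mp hn
    rw [hn.neg_one_pow, hk.neg_one_pow] at h1
    linarith

theorem apply_X_mul_self (hP : IsMonicOrthogonal L P)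
    (hL : ∀ p : ℝ[X], L (p.comp (-X)) = L p) (n : ℕ) : L (P n * (X * P n)) = 0 := by
  have h1 := hL (P n * (X * P n))
  have h2 : (P n * (X * P n)).comp (-X) = -(P n * (X * P n)) := by
    rw [mul_comp, mul_comp, X_comp, hP.comp_neg_X hL]
    have : C ((-1 : ℝ) ^ n) * C ((-1) ^ n) = 1 := by
      rw [← C_mul, ← mul_pow]; simp
    linear_combination (-(P n * (X * P n))) * this
  rw [h2, map_neg] at h1
  linarith

theorem coeff_X_mul_eq (hP : IsMonicOrthogonal L P) (n : ℕ) : (X * P n).coeff (n + 1) = 1 := by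
  rw [coeff_X_mul, hP.coeff_self]

theorem degree_X_mul_lt (hP : IsMonicOrthogonal L P) {m n : ℕ} (h : m + 1 < n) :
    (X * P m).degree < (n : WithBot ℕ) := by
  rw [degree_lt_iff_coeff_zero]
  intro k hk
  obtain ⟨k, rfl⟩ : ∃ i, k = i + 1 := ⟨k - 1, by omega⟩
  rw [coeff_X_mul, hP.coeff_eq_zero (by omega)]

theorem apply_mul_X_mul (hP : IsMonicOrthogonal L P) (n : ℕ) :
    L (P (n + 1) * (X * P n)) = L (P (n + 1) * P (n + 1)) := by
  rw [hP.apply_mul (hP.degree_X_mul_lt (Nat.lt_succ_self _)), hP.coeff_X_mul_eq, one_mul]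

theorem X_mul_zero (hP : IsMonicOrthogonal L P) (hL : ∀ p : ℝ[X], L (p.comp (-X)) = L p) :
    X * P 0 = P 1 := by
  rw [← sub_eq_zero]
  have hd := hP.degree_sub_lt (hP.degree_X_mul_lt (Nat.lt_succ_self (0 + 1)))
  rw [hP.coeff_X_mul_eq, C_1, one_mul] at hd
  refine hP.eq_zero hd fun j hj => ?_
  obtain rfl : j = 0 := by omega
  rw [mul_sub, map_sub, hP.apply_X_mul_self hL, hP.orthogonal zero_ne_one, sub_zero]

theorem X_mul_succ (hP : IsMonicOrthogonal L P) (hL : ∀ p : ℝ[X], L (p.comp (-X)) = L p)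
    (n : ℕ) : X * P (n + 1) =
      P (n + 2) + C (L (P (n + 1) * P (n + 1)) / L (P n * P n)) * P n := by
  rw [← sub_eq_zero, ← sub_sub]
  have hd := hP.degree_sub_lt (hP.degree_X_mul_lt (Nat.lt_succ_self (n + 1 + 1)))
  rw [hP.coeff_X_mul_eq, C_1, one_mul] at hd
  refine hP.eq_zero (m := n + 2) ?_ fun j hj => ?_
  · refine (Polynomial.degree_sub_le _ _).trans_lt (max_lt hd ?_)
    rw [← smul_eq_C_mul]
    exact (degree_smul_le _ _).trans_lt (hP.degree_lt (by omega))
  rw [mul_sub, mul_sub, map_sub, map_sub, mul_left_comm (P j) (C _), ← smul_eq_C_mul, map_smul,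
    hP.orthogonal (show j ≠ n + 2 by omega), sub_zero, smul_eq_mul]
  rcases (show j = n + 1 ∨ j = n ∨ j < n by omega) with rfl | rfl | hj
  · rw [hP.apply_X_mul_self hL, hP.orthogonal (show n + 1 ≠ n by omega)]
    simp
  · rw [show P j * (X * P (j + 1)) = P (j + 1) * (X * P j) by ring, hP.apply_mul_X_mul]
    have := (hP.norm_pos j).ne'
    field_simp
    simp
  · rw [mul_left_comm, ← mul_assoc, mul_comm, hP.orthogonal hj.ne, mul_zero, sub_zero]
    exact hP.apply_mul_eq_zero (hP.degree_X_mul_lt (by omega))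

/-- The coefficient `βₙ` of the three-term recurrence `x Pₙ = Pₙ₊₁ + βₙ Pₙ₋₁`. -/
noncomputable def recCoeff (hn : ℕ → ℝ) : ℕ → ℝ
  | 0 => 0
  | n + 1 => hn (n + 1) / hn n

theorem apply_X_mul_X_mul (hP : IsMonicOrthogonal L P)
    (hL : ∀ p : ℝ[X], L (p.comp (-X)) = L p) {c : ℕ → ℝ} (hc : ∀ n, L (P n * P n) = c n)
    (n : ℕ) : L (X * P n * (X * P n)) = c n * (recCoeff c (n + 1) + recCoeff c n) := by
  have hne (n : ℕ) : c n ≠ 0 := hc n ▸ (hP.norm_pos n).ne'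
  cases n with
  | zero =>
    rw [hP.X_mul_zero hL, hc]
    have := hne 0
    simp [recCoeff]
    field_simp
  | succ n =>
    rw [hP.X_mul_succ hL, hc, hc, ← smul_eq_C_mul]
    have h1 := hP.orthogonal (show n + 2 ≠ n by omega)
    have h2 := hP.orthogonal (show n ≠ n + 2 by omega)
    simp only [add_mul, mul_add, smul_mul_assoc, mul_smul_comm, map_add, map_smul, h1, h2, hc,
      smul_eq_mul, recCoeff]
    have := hne n
    have := hne (n + 1)
    field_simp
    ring

end IsMonicOrthogonal

section Moments

variable {t : ℝ} {P : ℕ → ℝ[X]}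

theorem eq_C_add_X_mul_divX (p : ℝ[X]) : p = C (p.coeff 0) + X * p.divX := by
  rw [add_comm, X_mul_divX_add]

theorem degree_divX_lt_of_degree_lt {p : ℝ[X]} {n : ℕ} (hp : p.degree < (n + 1 : ℕ)) :
    p.divX.degree < n := by
  rw [degree_lt_iff_coeff_zero] at hp ⊢
  intro k hk
  rw [coeff_divX, hp _ (by omega)]

theorem moment_C_mul (ht : 0 < t) (j : ℕ) (a : ℝ) (p : ℝ[X]) :
    moment t ht j (C a * p) = a * moment t ht j p := by
  rw [← smul_eq_C_mul, map_smul, smul_eq_mul]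

theorem moment_mul_moment (ht : 0 < t) {O E : ℝ[X]} (hO0 : O.coeff 0 = 0) (hO2 : O.coeff 2 = 0)
    (hE1 : E.coeff 1 = 0) (hO : moment t ht 0 (O * O.divX.divX) = 0)
    (hE : moment t ht 0 (E * E.divX.divX) = 0) (hOE : moment t ht 0 (E * O.divX.divX.divX) = 0) :
    moment t ht 2 (O * O) * moment t ht 2 (E * E) =
      (moment t ht 0 (O.divX * E) - moment t ht 0 (O * E.divX)) * moment t ht 3 (O * E) := by
  set S := O.divX with hS
  have hOS : O = X * S := by simpa [hO0] using eq_C_add_X_mul_divX O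
  have hSS : S = C (O.coeff 1) + X * S.divX := by simpa [hS] using eq_C_add_X_mul_divX S
  have hS2 : S.divX = X * S.divX.divX := by
    simpa [hS, hO2] using eq_C_add_X_mul_divX S.divX
  have hEE := eq_C_add_X_mul_divX E
  have hE2 : E.divX = X * E.divX.divX := by simpa [hE1] using eq_C_add_X_mul_divX E.divX
  have e1 : moment t ht 2 (O * O) = O.coeff 1 * moment t ht 1 O := by
    have : O * O = X * (C (O.coeff 1) * O + X * (O * S.divX)) := by
      linear_combination O * hOS + X * O * hSS
    rw [this, moment_succ_X_mul, map_add, moment_succ_X_mul, hO, add_zero, moment_C_mul]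
  have e2 : moment t ht 2 (E * E) = E.coeff 0 * moment t ht 2 E := by
    have : E * E = C (E.coeff 0) * E + X * (X * (E * E.divX.divX)) := by
      linear_combination E * hEE + X * E * hE2
    rw [this, map_add, moment_succ_X_mul, moment_succ_X_mul, hE, add_zero, moment_C_mul]
  have e3 : moment t ht 3 (O * E) = O.coeff 1 * moment t ht 2 E := by
    have : O * E = X * (C (O.coeff 1) * E + X * (X * (E * S.divX.divX))) := by
      linear_combination E * hOS + X * E * hSS + X * X * E * hS2
    rw [this, moment_succ_X_mul, map_add, moment_succ_X_mul, moment_succ_X_mul, hOE, add_zero,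
      moment_C_mul]
  have e4 : moment t ht 0 (S * E) = E.coeff 0 * moment t ht 1 O + moment t ht 0 (O * E.divX) := by
    have : X * (S * E) = C (E.coeff 0) * O + X * (O * E.divX) := by
      linear_combination (-E) * hOS + O * hEE
    rw [← moment_succ_X_mul ht 0 (S * E), this, map_add, moment_succ_X_mul, moment_C_mul]
  rw [e1, e2, e3, e4]
  ring

theorem moment_two_mul_self (ht : 0 < t) (hP : IsMonicOrthogonal (moment t ht 0) P)
    {c : ℕ → ℝ} (hc : ∀ n, moment t ht 0 (P n * P n) = c n) (n : ℕ) :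
    2 * t * moment t ht 2 (P n * P n) =
      c n * (2 * IsMonicOrthogonal.recCoeff c (n + 1) + 2 * IsMonicOrthogonal.recCoeff c n
        - (2 * n + 1)) := by
  have h1 := moment_derivative ht (X * (P n * P n))
  have h2 := hP.apply_X_mul_X_mul (moment_zero_comp_neg_X ht) hc n
  have hd : (X * derivative (P n)).degree < ((n + 1 : ℕ) : WithBot ℕ) := by
    rw [degree_lt_iff_coeff_zero]
    intro k hk
    obtain ⟨k, rfl⟩ : ∃ i, k = i + 1 := ⟨k - 1, by omega⟩
    rw [coeff_X_mul, coeff_derivative, hP.coeff_eq_zero (by omega), zero_mul]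
  have h3 := hP.apply_mul hd
  have h4 : (X * derivative (P n)).coeff n = (n : ℝ) := by
    cases n with
    | zero => simp
    | succ n =>
      rw [coeff_X_mul, coeff_derivative, hP.coeff_self, one_mul]
      push_cast; rfl
  have h5 : derivative (X * (P n * P n)) =
      P n * P n + (2 : ℝ) • (P n * (X * derivative (P n))) := by
    rw [derivative_mul, derivative_mul, derivative_X, smul_eq_C_mul, C_ofNat]
    ring
  rw [h5, map_add, map_smul, smul_eq_mul, h3, h4, hc, moment_succ_X_mul,
    show X * (X * (P n * P n)) = X * P n * (X * P n) by ring, h2] at h1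
  linarith

theorem moment_three_mul_succ (ht : 0 < t) (hP : IsMonicOrthogonal (moment t ht 0) P)
    {c : ℕ → ℝ} (hc : ∀ n, moment t ht 0 (P n * P n) = c n) (n : ℕ) :
    2 * t * moment t ht 3 (P (n + 1) * P n) = 2 * c (n + 1) - (n + 1) * c n := by
  have h1 := moment_derivative ht (P (n + 1) * P n)
  have hd : ∀ m : ℕ, (derivative (P (m + 1))).degree < (m + 1 : ℕ) := by
    intro m
    rw [degree_lt_iff_coeff_zero]
    intro k hk
    rw [coeff_derivative, hP.coeff_eq_zero (by omega), zero_mul]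
  have h2 : moment t ht 0 (P (n + 1) * derivative (P n)) = 0 := by
    refine hP.apply_mul_eq_zero ?_
    rw [degree_lt_iff_coeff_zero]
    intro k hk
    rw [coeff_derivative, hP.coeff_eq_zero (by omega), zero_mul]
  have h3 := hP.apply_mul (hd n)
  rw [coeff_derivative, hP.coeff_self, one_mul, hc] at h3
  rw [derivative_mul, mul_comm (derivative _), map_add, h2, h3, mul_left_comm,
    hP.apply_mul_X_mul, hc] at h1
  linarith

theorem moment_two_mul_moment_two_succ (ht : 0 < t) (hP : IsMonicOrthogonal (moment t ht 0) P)
    {c : ℕ → ℝ} (hc : ∀ n, moment t ht 0 (P n * P n) = c n) (n : ℕ) :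
    moment t ht 2 (P (n + 1) * P (n + 1)) * moment t ht 2 (P n * P n) =
      (-1) ^ n * c n * moment t ht 3 (P (n + 1) * P n) := by
  have hodd {m k : ℕ} (h : Odd (m + k)) : (P m).coeff k = 0 :=
    hP.coeff_eq_zero_of_odd_add (moment_zero_comp_neg_X ht) h
  have hlt {m N : ℕ} (h : m < N) : (P m).degree < N := hP.degree_lt h
  have hdiv {p : ℝ[X]} {N : ℕ} (h : p.degree < (N : ℕ)) : p.divX.degree < N := by
    rw [degree_lt_iff_coeff_zero] at h ⊢
    intro k hk
    rw [coeff_divX, h _ (by omega)]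
  have hsucc : (P (n + 1)).divX.degree < (n + 1 : ℕ) :=
    degree_divX_lt_of_degree_lt (hlt (Nat.lt_succ_self _))
  have hself {m : ℕ} : (P m).divX.degree < m :=
    degree_divX_lt_of_degree_lt (hlt (Nat.lt_succ_self _))
  have hmain : moment t ht 0 (P n * (P (n + 1)).divX) = c n := by
    rw [hP.apply_mul hsucc, coeff_divX, hP.coeff_self, one_mul, hc]
  have hzero : moment t ht 0 (P (n + 1) * (P n).divX) = 0 :=
    hP.apply_mul_eq_zero (hdiv (hlt (Nat.lt_succ_self _)))
  rcases n.even_or_odd with hn | hn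
  · rw [moment_mul_moment ht (hodd (by simpa using hn.add_one))
      (hodd (by rw [add_assoc]; exact hn.add_odd (by decide))) (hodd hn.add_one)
      (hP.apply_mul_eq_zero (hdiv hself)) (hP.apply_mul_eq_zero (hdiv hself))
      (hP.apply_mul_eq_zero (hdiv (degree_divX_lt_of_degree_lt hsucc))),
      hn.neg_one_pow, hzero, mul_comm _ (P n), hmain]
    ring
  · rw [mul_comm, moment_mul_moment ht (hodd (by simpa using hn))
      (hodd (hn.add_even (by decide)))
      (hodd hn.add_one.add_one)
      (hP.apply_mul_eq_zero (hdiv hself)) (hP.apply_mul_eq_zero (hdiv hself))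
      (hP.apply_mul_eq_zero (hdiv (hdiv (hdiv (hlt (Nat.lt_succ_self _)))))),
      hn.neg_one_pow, hmain, mul_comm _ (P (n + 1)), hzero, mul_comm (P n)]
    ring

end Moments

section Deformation

open IsMonicOrthogonal

variable {P : ℕ → ℝ → ℝ[X]} {h : ℕ → ℝ → ℝ}

theorem hasDerivAt_sq_norm
    (hP : ∀ s (hs : 0 < s), IsMonicOrthogonal (moment s hs 0) fun n => P n s)
    (hcoeff : ∀ n k : ℕ, ∀ t : ℝ, 0 < t → DifferentiableAt ℝ (fun s => (P n s).coeff k) t)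
    (hh : ∀ n s (hs : 0 < s), moment s hs 0 (P n s * P n s) = h n s) (n : ℕ) {t : ℝ} (ht : 0 < t) :
    HasDerivAt (h n) (-moment t ht 2 (P n t * P n t)) t := by
  set Q := P n t with hQ
  have hexp (s : ℝ) (hs : 0 < s) :
      P n s = ∑ k ∈ Finset.range (n + 1), C ((P n s).coeff k) * X ^ k := by
    conv_lhs => rw [(P n s).as_sum_range_C_mul_X_pow, (hP s hs).natDegree_eq]
  have heq : h n =ᶠ[nhds t] fun s => ∑ k ∈ Finset.range (n + 1),
      (P n s).coeff k * ∫ x : ℝ, (X ^ k * Q).eval x * w s x := by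
    filter_upwards [lt_mem_nhds ht] with s hs
    have h1 : moment s hs 0 (P n s * Q) = h n s := by
      rw [(hP s hs).apply_mul, hh, hQ, (hP t ht).coeff_self, one_mul]
      exact (hP t ht).degree_lt n.lt_succ_self
    rw [← h1]
    conv_lhs => rw [hexp s hs]
    simp only [Finset.sum_mul, map_sum, mul_assoc, moment_C_mul, moment_zero_apply]
  have hderiv := HasDerivAt.fun_sum fun k (_ : k ∈ Finset.range (n + 1)) =>
    (hcoeff n k t ht).hasDerivAt.mul (hasDerivAt_integral_eval_mul_w ht (X ^ k * Q))
  refine (hderiv.congr_of_eventuallyEq heq).congr_deriv ?_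
  have hzero (k : ℕ) (hk : k ∈ Finset.range (n + 1)) :
      deriv (fun s => (P n s).coeff k) t * ∫ x : ℝ, (X ^ k * Q).eval x * w t x = 0 := by
    rcases (Nat.lt_succ_iff.mp (Finset.mem_range.mp hk)).eq_or_lt with rfl | hk
    · have : (fun s => (P k s).coeff k) =ᶠ[nhds t] fun _ => 1 := by
        filter_upwards [lt_mem_nhds ht] with s hs using (hP s hs).coeff_self k
      rw [this.deriv_eq, deriv_const, zero_mul]
    · rw [← moment_zero_apply ht, mul_comm (X ^ k), (hP t ht).apply_mul_eq_zero, mul_zero]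
      rw [degree_X_pow]
      exact_mod_cast hk
  rw [Finset.sum_add_distrib, Finset.sum_eq_zero hzero, zero_add]
  have hsum := congrArg (fun q => moment t ht 2 (q * Q)) (hexp t ht)
  simp only [Finset.sum_mul, map_sum, mul_assoc, moment_C_mul] at hsum
  simp only [mul_neg, Finset.sum_neg_distrib, hQ] at hsum ⊢
  rw [hsum]

end Deformation

open IsMonicOrthogonal in
theorem hasDerivAt_recCoeff {t : ℝ} (ht : 0 < t) {h R : ℕ → ℝ → ℝ} (hpos : ∀ n, h n t ≠ 0)
    (hRpos : ∀ n, R n t ≠ 0)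
    (hh : ∀ n, HasDerivAt (h n) (-(h n t * R n t / (2 * t))) t)
    (hRR : ∀ n, recCoeff (h · t) (n + 1) * R (n + 1) t * R n t =
      2 * t * (-1) ^ n * (2 * recCoeff (h · t) (n + 1) - (n + 1))) (n : ℕ) :
    HasDerivAt (fun s => recCoeff (h · s) n)
      (-(-1) ^ n * (2 * recCoeff (h · t) n - n) / R n t
        - recCoeff (h · t) n * R n t / (2 * t)) t := by
  cases n with
  | zero => simpa [recCoeff] using hasDerivAt_const t (0 : ℝ)
  | succ n =>
    have h1 := hpos n
    have h2 := hRpos (n + 1)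
    have h3 := hRR n
    refine ((hh (n + 1)).div (hh n) h1).congr_deriv ?_
    have h4 : -(-1) ^ (n + 1) * (2 * recCoeff (h · t) (n + 1) - (n + 1 : ℕ)) / R (n + 1) t =
        recCoeff (h · t) (n + 1) * R n t / (2 * t) := by
      rw [div_eq_div_iff h2 (by positivity)]
      push_cast
      linear_combination -h3
    rw [h4]
    simp only [recCoeff]
    field_simp
    ring

theorem neg_sum_range_eq {t : ℝ} {β R : ℕ → ℝ} (hR0 : ∀ n, R n ≠ 0) (hβ : β 0 = 0)
    (hR : ∀ n : ℕ, R n = 2 * β (n + 1) + 2 * β n - (2 * n + 1))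
    (hRR : ∀ n : ℕ, β (n + 1) * R (n + 1) * R n = 2 * t * (-1) ^ n * (2 * β (n + 1) - (n + 1)))
    (n : ℕ) :
    -∑ j ∈ Finset.range n, R j = (2 * β n - n) ^ 2 + 2 * t * (1 - (-1) ^ n) - 2 * β n * R n
      + 4 * t * (-1) ^ n * (2 * β n - n) / R n := by
  induction n with
  | zero => simp [hβ]
  | succ n ih =>
    rw [Finset.sum_range_succ, neg_add, ih]
    have h1 : 2 * β (n + 1) * R (n + 1) = 4 * t * (-1) ^ n * (2 * β (n + 1) - (n + 1)) / R n := by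
      rw [eq_div_iff (hR0 n)]
      linear_combination 2 * hRR n
    have h2 : 4 * t * (-1) ^ (n + 1) * (2 * β (n + 1) - (n + 1 : ℕ)) / R (n + 1) =
        -2 * β (n + 1) * R n := by
      rw [div_eq_iff (hR0 (n + 1))]
      push_cast
      linear_combination 2 * hRR n
    have h3 : 4 * t * (-1) ^ n * (2 * β (n + 1) - (n + 1)) / R n =
        4 * t * (-1) ^ n - 4 * t * (-1) ^ n * (2 * β n - n) / R n := by
      rw [eq_sub_iff_add_eq, ← add_div, div_eq_iff (hR0 n)]
      linear_combination -4 * t * (-1) ^ n * hR n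
    rw [h2, h1, h3]
    push_cast
    linear_combination (2 * β (n + 1) - 1 - 2 * β n) * hR n

open IsMonicOrthogonal in
theorem statement18
    (P : ℕ → ℝ → Polynomial ℝ)
    (hmonic : ∀ n : ℕ, ∀ t : ℝ, 0 < t → (P n t).Monic)
    (hdeg : ∀ n : ℕ, ∀ t : ℝ, 0 < t → (P n t).natDegree = n)
    (horth : ∀ m n : ℕ, m ≠ n → ∀ t : ℝ, 0 < t →
      ∫ x : ℝ, (P m t).eval x * (P n t).eval x * w t x = 0)
    (hcoeff : ∀ n k : ℕ, ∀ t : ℝ, 0 < t →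
      DifferentiableAt ℝ (fun s => (P n s).coeff k) t)
    (h : ℕ → ℝ → ℝ)
    (hh : ∀ n : ℕ, ∀ t : ℝ, 0 < t → h n t = ∫ x : ℝ, ((P n t).eval x) ^ 2 * w t x)
    (hhpos : ∀ n : ℕ, ∀ t : ℝ, 0 < t → 0 < h n t)
    (R : ℕ → ℝ → ℝ)
    (hR : ∀ n : ℕ, ∀ t : ℝ, 0 < t →
      R n t = 2 * t / h n t * ∫ y : ℝ, ((P n t).eval y) ^ 2 / y ^ 2 * w t y)
    (hRpos : ∀ n : ℕ, ∀ t : ℝ, 0 < t → 0 < R n t)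
    (σ : ℕ → ℝ → ℝ)
    (hσ : ∀ n : ℕ, ∀ t : ℝ, 0 < t → σ n t = -∑ j ∈ Finset.range n, R j t)
    (n : ℕ) (hn : 1 ≤ n) (t : ℝ) (ht : 0 < t) :
    ∃ d : ℝ, HasDerivAt (R n) d t ∧
      σ n t = 1 / 4 + 2 * t - (n : ℝ) * R n t - (R n t) ^ 2 / 4
        - t * d / R n t + t ^ 2 * (d ^ 2 - 4) / (R n t) ^ 2 := by
  have hnorm (n : ℕ) (s : ℝ) (hs : 0 < s) : moment s hs 0 (P n s * P n s) = h n s := by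
    rw [hh n s hs, moment_zero_apply]
    simp only [eval_mul, pow_two]
  have hP (s : ℝ) (hs : 0 < s) : IsMonicOrthogonal (moment s hs 0) fun n => P n s :=
    { monic := fun n => hmonic n s hs
      natDegree_eq := fun n => hdeg n s hs
      orthogonal := fun hmn => by
        simpa only [moment_zero_apply, eval_mul] using horth _ _ hmn s hs
      norm_pos := fun n => hnorm n s hs ▸ hhpos n s hs }
  have hRm (n : ℕ) (s : ℝ) (hs : 0 < s) :
      h n s * R n s = 2 * s * moment s hs 2 (P n s * P n s) := by
    have := (hhpos n s hs).ne'
    rw [hR n s hs, moment_apply]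
    simp only [eval_mul, pow_two]
    field_simp
  have hRβ (n : ℕ) (s : ℝ) (hs : 0 < s) :
      R n s = 2 * recCoeff (h · s) (n + 1) + 2 * recCoeff (h · s) n - (2 * n + 1) := by
    refine mul_left_cancel₀ (hhpos n s hs).ne' ?_
    rw [hRm n s hs, moment_two_mul_self hs (hP s hs) (c := (h · s)) (fun n => hnorm n s hs)]
  have hRR (n : ℕ) : recCoeff (h · t) (n + 1) * R (n + 1) t * R n t =
      2 * t * (-1) ^ n * (2 * recCoeff (h · t) (n + 1) - (n + 1)) := by
    have h0 := (hhpos n t ht).ne'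
    have e1 := hRm n t ht
    have e2 := hRm (n + 1) t ht
    have e3 := moment_three_mul_succ ht (hP t ht) (c := (h · t)) (fun n => hnorm n t ht) n
    have e4 := moment_two_mul_moment_two_succ ht (hP t ht) (c := (h · t))
      (fun n => hnorm n t ht) n
    have e5 : (h (n + 1) t * R (n + 1) t) * (h n t * R n t) =
        2 * t * (-1) ^ n * h n t * (2 * h (n + 1) t - (n + 1) * h n t) := by
      rw [e1, e2, ← e3]
      linear_combination 4 * t ^ 2 * e4
    simp only [recCoeff]
    field_simp
    refine mul_left_cancel₀ h0 ?_
    linear_combination e5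
  have hh' (n : ℕ) : HasDerivAt (h n) (-(h n t * R n t / (2 * t))) t := by
    refine (hasDerivAt_sq_norm hP hcoeff hnorm n ht).congr_deriv ?_
    rw [hRm n t ht]
    field_simp
  have hβ' := hasDerivAt_recCoeff ht (fun n => (hhpos n t ht).ne') (fun n => (hRpos n t ht).ne')
    hh' hRR
  have hRn := (hRpos n t ht).ne'
  have hRR' : recCoeff (h · t) (n + 1) * R (n + 1) t =
      2 * t * (-1) ^ n * (2 * recCoeff (h · t) (n + 1) - (n + 1)) / R n t := by
    rw [eq_div_iff hRn, hRR]
  have hderiv : HasDerivAt (R n) _ t :=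
    ((((hβ' (n + 1)).const_mul 2).add ((hβ' n).const_mul 2)).sub_const
      (2 * n + 1 : ℝ)).congr_of_eventuallyEq <| by
        filter_upwards [lt_mem_nhds ht] with s hs using hRβ n s hs
  refine ⟨_, hderiv.congr_deriv (g' := (-2 * t * (-1) ^ n
    + R n t * (1 + R n t - 2 * (2 * recCoeff (h · t) n - n)) / 2) / t) ?_, ?_⟩
  · have e : -(-1) ^ (n + 1) * (2 * recCoeff (h · t) (n + 1) - (n + 1 : ℕ)) / R (n + 1) t =
        recCoeff (h · t) (n + 1) * R n t / (2 * t) := by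
      rw [div_eq_div_iff (hRpos _ t ht).ne' (by positivity)]
      push_cast
      linear_combination -(hRR n)
    rw [e, mul_div_assoc _ (R (n + 1) t), mul_div_assoc', hRR']
    have := hRβ n t ht
    have hβn : recCoeff (h · t) (n + 1) = (R n t + 2 * n + 1) / 2 - recCoeff (h · t) n := by
      linarith
    rw [hβn]
    field_simp
    ring
  · rw [hσ n t ht, neg_sum_range_eq (fun n => (hRpos n t ht).ne') rfl (fun n => hRβ n t ht) hRR n]
    have hs : ((-1 : ℝ) ^ n) ^ 2 = 1 := by rw [← pow_mul, mul_comm, pow_mul]; simp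
    generalize ((-1 : ℝ) ^ n) = s at hs
    field_simp
    linear_combination -64 * t ^ 2 * hs
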